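/- For every ε > 0 there exists D such that for every d ≥ D and every d-regular graph G on n vertices, log₂ mis(G) ≤ (1+ε) · n·log₂3 / 6. -/

import Mathlib

/-- The number of maximal independent sets of a graph `G`. -/
noncomputable def mis {V : Type*} (G : SimpleGraph V) : ℕ :=
  {I : Set V | Maximal (fun s : Set V => s.Pairwise fun a b => ¬ G.Adj a b) I}.ncard

open scoped Classical in
/-- The maximal independent sets of the subgraph of `G` induced on `W`. -/
noncomputable def maximalIndepIn {V : Type*} (G : SimpleGraph V) (W : Finset V) :
    Finset (Finset V) :=
  {I ∈ W.powerset | (∀ a ∈ I, ∀ b ∈ I, ¬ G.Adj a b) ∧ ∀ v ∈ W, v ∉ I → ∃ u ∈ I, G.Adj u v}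

theorem mem_maximalIndepIn {V : Type*} {G : SimpleGraph V} {W I : Finset V} :
    I ∈ maximalIndepIn G W ↔ I ⊆ W ∧ (∀ a ∈ I, ∀ b ∈ I, ¬ G.Adj a b) ∧
      ∀ v ∈ W, v ∉ I → ∃ u ∈ I, G.Adj u v := by
  simp [maximalIndepIn]

theorem maximalIndepIn_mono {V : Type*} {G : SimpleGraph V} {W W' I : Finset V}
    (hI : I ∈ maximalIndepIn G W') (hW : W ⊆ W') (hIW : I ⊆ W) : I ∈ maximalIndepIn G W := by
  rw [mem_maximalIndepIn] at *
  exact ⟨hIW, hI.2.1, fun v hv => hI.2.2 v (hW hv)⟩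

open scoped Classical in
theorem erase_mem_maximalIndepIn {V : Type*} {G : SimpleGraph V} {W I : Finset V} {u : V}
    (hI : I ∈ maximalIndepIn G W) (hu : u ∈ I) :
    I.erase u ∈ maximalIndepIn G {w ∈ W | ¬ (w = u ∨ G.Adj u w)} := by
  rw [mem_maximalIndepIn] at *
  obtain ⟨hIW, hind, hmax⟩ := hI
  refine ⟨fun w hw => ?_, fun a ha b hb => ?_, fun v hv hvI => ?_⟩
  · rw [Finset.mem_erase] at hw
    simp only [Finset.mem_filter, not_or]
    exact ⟨hIW hw.2, hw.1, hind u hu w hw.2⟩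
  · exact hind a (Finset.mem_of_mem_erase ha) b (Finset.mem_of_mem_erase hb)
  · simp only [Finset.mem_filter, not_or] at hv
    obtain ⟨x, hx, hxv⟩ := hmax v hv.1 fun h => hvI (Finset.mem_erase.2 ⟨hv.2.1, h⟩)
    refine ⟨x, Finset.mem_erase.2 ⟨?_, hx⟩, hxv⟩
    rintro rfl
    exact hv.2.2 hxv

theorem cube_le_three_pow (k : ℕ) : k ^ 3 ≤ 3 ^ k := by
  rcases lt_or_ge k 3 with h | h
  · interval_cases k <;> norm_num
  · induction k, h using Nat.le_induction with
    | base => norm_num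
    | succ k hk ih =>
      rw [pow_succ 3 k]
      nlinarith [Nat.mul_le_mul hk hk, Nat.mul_le_mul (Nat.mul_le_mul hk hk) hk,
        Nat.mul_le_mul_left (k ^ 2) hk]

/-- The Moon–Moser bound: a graph on `n` vertices has at most `3 ^ (n / 3)` maximal independent
sets. -/
theorem card_maximalIndepIn_le {V : Type*} (G : SimpleGraph V) {c : ℝ} (hc : 0 ≤ c)
    (hc3 : c ^ 3 = 3) (W : Finset V) : ((maximalIndepIn G W).card : ℝ) ≤ c ^ W.card := by
  classical
  have hc1 : 1 ≤ c := by
    by_contra! h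
    have := pow_le_one₀ (n := 3) hc h.le
    linarith
  induction W using Finset.strongInduction with
  | H W ih =>
  rcases W.eq_empty_or_nonempty with rfl | hW
  · have : (maximalIndepIn G (∅ : Finset V)).card ≤ 1 := by
      refine Finset.card_le_one.2 fun a ha b hb => ?_
      rw [mem_maximalIndepIn, Finset.subset_empty] at ha hb
      rw [ha.1, hb.1]
    simpa using this
  let nbhd : V → Finset V := fun u => {w ∈ W | w = u ∨ G.Adj u w}
  let rest : V → Finset V := fun u => {w ∈ W | ¬ (w = u ∨ G.Adj u w)}
  obtain ⟨v, hv, hvmin⟩ := W.exists_min_image (fun u => (nbhd u).card) hW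
  have hcover : maximalIndepIn G W ⊆
      (nbhd v).biUnion fun u => (maximalIndepIn G (rest u)).image (insert u) := by
    intro I hI
    obtain ⟨hIW, -, hmax⟩ := mem_maximalIndepIn.1 hI
    obtain ⟨u, huI, hu⟩ : ∃ u ∈ I, u = v ∨ G.Adj v u := by
      by_cases h : v ∈ I
      · exact ⟨v, h, Or.inl rfl⟩
      · obtain ⟨u, hu, huv⟩ := hmax v hv h
        exact ⟨u, hu, Or.inr huv.symm⟩
    refine Finset.mem_biUnion.2 ⟨u, Finset.mem_filter.2 ⟨hIW huI, hu⟩, ?_⟩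
    exact Finset.mem_image.2
      ⟨I.erase u, erase_mem_maximalIndepIn hI huI, Finset.insert_erase huI⟩
  have hsplit (u : V) : (nbhd u).card + (rest u).card = W.card :=
    Finset.card_filter_add_card_filter_not _
  have hterm : ∀ u ∈ nbhd v, ((maximalIndepIn G (rest u)).card : ℝ) ≤ c ^ (rest v).card := by
    intro u hu
    have huW : u ∈ W := (Finset.mem_filter.1 hu).1
    refine (ih (rest u) ?_).trans (pow_le_pow_right₀ hc1 ?_)
    · exact Finset.filter_ssubset.2 ⟨u, huW, by simp⟩
    · have := hvmin u huW
      have := hsplit u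
      have := hsplit v
      omega
  have hk : ((nbhd v).card : ℝ) ≤ c ^ (nbhd v).card := by
    refine le_of_pow_le_pow_left₀ three_ne_zero (by positivity) ?_
    rw [← pow_mul, mul_comm, pow_mul, hc3]
    exact_mod_cast cube_le_three_pow _
  calc ((maximalIndepIn G W).card : ℝ)
      ≤ ∑ u ∈ nbhd v, ((maximalIndepIn G (rest u)).card : ℝ) := by
        exact_mod_cast (Finset.card_le_card hcover).trans
          (Finset.card_biUnion_le.trans (Finset.sum_le_sum fun _ _ => Finset.card_image_le))
    _ ≤ (nbhd v).card * c ^ (rest v).card := by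
        simpa using Finset.sum_le_sum hterm
    _ ≤ c ^ (nbhd v).card * c ^ (rest v).card := by gcongr
    _ = c ^ W.card := by rw [← pow_add, hsplit]

open scoped Classical in
/-- The vertices adjacent to some member of `T`. -/
noncomputable def neighborsOf {V : Type*} [Fintype V] (G : SimpleGraph V) (T : Finset V) :
    Finset V :=
  {v | ∃ t ∈ T, G.Adj t v}

open scoped Classical in
/-- The vertices outside the neighbourhood of `T` having fewer than `m` neighbours outside it. -/
noncomputable def container {V : Type*} [Fintype V] (G : SimpleGraph V) (m : ℕ) (T : Finset V) :
    Finset V :=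
  {v | v ∉ neighborsOf G T ∧ (neighborsOf G {v} \ neighborsOf G T).card < m}

theorem mem_neighborsOf {V : Type*} [Fintype V] {G : SimpleGraph V} {T : Finset V} {v : V} :
    v ∈ neighborsOf G T ↔ ∃ t ∈ T, G.Adj t v := by
  simp [neighborsOf]

theorem exists_fingerprint {V : Type*} [Fintype V] (G : SimpleGraph V) {m : ℕ} (hm0 : 0 < m)
    {I : Finset V} (hI : I ∈ maximalIndepIn G Finset.univ) :
    ∃ T : Finset V, m * T.card ≤ Fintype.card V ∧ I ∈ maximalIndepIn G (container G m T) := by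
  classical
  let S : Finset (Finset V) := {T ∈ I.powerset | m * T.card ≤ (neighborsOf G T).card}
  obtain ⟨T, hT, hTmax⟩ := S.exists_max_image Finset.card ⟨∅, by simp [S]⟩
  obtain ⟨hTI, hTm⟩ : T ⊆ I ∧ m * T.card ≤ (neighborsOf G T).card := by simpa [S] using hT
  refine ⟨T, hTm.trans (Finset.card_le_univ _),
    maximalIndepIn_mono hI (Finset.subset_univ _) fun v hv => ?_⟩
  simp only [container, Finset.mem_filter, Finset.mem_univ, true_and]
  have hind := (mem_maximalIndepIn.1 hI).2.1
  refine ⟨fun h => ?_, ?_⟩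
  · obtain ⟨t, ht, htv⟩ := mem_neighborsOf.1 h
    exact hind t (hTI ht) v hv htv
  by_contra! hm
  by_cases hvT : v ∈ T
  · have hempty : neighborsOf G {v} \ neighborsOf G T = ∅ := by
      refine Finset.sdiff_eq_empty_iff_subset.2 fun w hw => ?_
      simp only [mem_neighborsOf, Finset.mem_singleton, exists_eq_left] at hw ⊢
      exact ⟨v, hvT, hw⟩
    rw [hempty, Finset.card_empty] at hm
    omega
  · have hunion : neighborsOf G (insert v T) =
        (neighborsOf G {v} \ neighborsOf G T) ∪ neighborsOf G T := by
      ext w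
      simp only [Finset.sdiff_union_self_eq_union, Finset.mem_union, mem_neighborsOf,
        Finset.mem_insert, Finset.mem_singleton, exists_eq_or_imp, exists_eq_left]
    have hcard := Finset.card_union_of_disjoint
      (Finset.sdiff_disjoint (s := neighborsOf G T) (t := neighborsOf G {v}))
    have hins : insert v T ∈ S := by
      simp only [S, Finset.mem_filter, Finset.mem_powerset]
      refine ⟨Finset.insert_subset hv hTI, ?_⟩
      rw [hunion, hcard, Finset.card_insert_of_notMem hvT, mul_add, mul_one]
      omega
    have := hTmax _ hins
    rw [Finset.card_insert_of_notMem hvT] at this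
    omega

theorem card_neighborsOf_singleton {V : Type*} [Fintype V] (G : SimpleGraph V) (v : V) :
    (neighborsOf G {v}).card = (G.neighborSet v).ncard := by
  rw [← Set.ncard_coe_finset]
  congr 1
  ext w
  simp [mem_neighborsOf]

theorem card_container_mul_le {V : Type*} [Fintype V] (G : SimpleGraph V) {d : ℕ}
    (hd : ∀ v, (G.neighborSet v).ncard = d) (m : ℕ) (T : Finset V) :
    (container G m T).card * (2 * d) ≤ d * Fintype.card V + (container G m T).card * m := by
  classical
  set W := container G m T
  set N := neighborsOf G T
  have hdisj : Disjoint W N := Finset.disjoint_left.2 fun v hv => (Finset.mem_filter.1 hv).2.1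
  have hsum : ∑ v ∈ W, (N.filter (G.Adj v)).card = ∑ u ∈ N, (W.filter (G.Adj · u)).card :=
    Finset.sum_card_bipartiteAbove_eq_sum_card_bipartiteBelow _
  have hlow : W.card * d ≤ ∑ v ∈ W, (N.filter (G.Adj v)).card + W.card * m := by
    rw [← smul_eq_mul, ← Finset.sum_const, ← smul_eq_mul, ← Finset.sum_const,
      ← Finset.sum_add_distrib]
    refine Finset.sum_le_sum fun v hv => ?_
    have hlt := (Finset.mem_filter.1 hv).2.2
    have heq : neighborsOf G {v} ∩ N = N.filter (G.Adj v) := by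
      ext w
      simp [mem_neighborsOf, and_comm]
    have := Finset.card_sdiff_add_card_inter (neighborsOf G {v}) N
    rw [card_neighborsOf_singleton, hd, heq] at this
    change (neighborsOf G {v} \ N).card < m at hlt
    omega
  have hup : ∑ u ∈ N, (W.filter (G.Adj · u)).card ≤ N.card * d := by
    rw [← smul_eq_mul, ← Finset.sum_const]
    refine Finset.sum_le_sum fun u _ => ?_
    rw [← hd u, ← card_neighborsOf_singleton]
    refine Finset.card_le_card fun w hw => ?_
    simp only [mem_neighborsOf, Finset.mem_singleton, exists_eq_left]
    exact (Finset.mem_filter.1 hw).2.symm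
  have hWN : W.card + N.card ≤ Fintype.card V := by
    rw [← Finset.card_union_of_disjoint hdisj]
    exact Finset.card_le_univ _
  nlinarith [Nat.mul_le_mul_left d hWN]

theorem card_small_sets_le {V : Type*} [Fintype V] {m : ℕ} (hm : 0 < m) :
    (((Finset.univ : Finset (Finset V)).filter fun T => m * T.card ≤ Fintype.card V).card : ℝ) ≤
      Real.exp (Fintype.card V * ((1 + Real.log m) / m)) := by
  have hm0 : (0 : ℝ) < m := by exact_mod_cast hm
  have hm1 : (1 : ℝ) ≤ m := by exact_mod_cast hm
  set n := Fintype.card V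
  set S := (Finset.univ : Finset (Finset V)).filter fun T => m * T.card ≤ n
  have hlog : 0 ≤ Real.log m := Real.log_nonneg hm1
  have hsum : ∑ T : Finset V, ((m : ℝ)⁻¹) ^ T.card = ((m : ℝ)⁻¹ + 1) ^ n := by
    have := Finset.sum_pow_mul_eq_add_pow ((m : ℝ)⁻¹) 1 (Finset.univ : Finset V)
    simpa [n] using this
  have hterm : ∀ T ∈ S, Real.exp (-(n * (Real.log m / m))) ≤ ((m : ℝ)⁻¹) ^ T.card := by
    intro T hT
    have hT' : (m : ℝ) * T.card ≤ n := by exact_mod_cast (Finset.mem_filter.1 hT).2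
    rw [← Real.exp_log (inv_pos.2 hm0), ← Real.exp_nat_mul, Real.log_inv, Real.exp_le_exp]
    have : (n : ℝ) * (Real.log m / m) ≥ T.card * Real.log m := by
      rw [mul_div_assoc', ge_iff_le, le_div_iff₀ hm0]
      nlinarith
    linarith
  have hS : (S.card : ℝ) * Real.exp (-(n * (Real.log m / m))) ≤ Real.exp (n * (m : ℝ)⁻¹) := by
    calc (S.card : ℝ) * Real.exp (-(n * (Real.log m / m)))
        ≤ ∑ T ∈ S, ((m : ℝ)⁻¹) ^ T.card := by simpa using Finset.sum_le_sum hterm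
      _ ≤ ∑ T : Finset V, ((m : ℝ)⁻¹) ^ T.card :=
          Finset.sum_le_sum_of_subset_of_nonneg (Finset.subset_univ _) fun _ _ _ => by positivity
      _ = ((m : ℝ)⁻¹ + 1) ^ n := hsum
      _ ≤ Real.exp (m : ℝ)⁻¹ ^ n := by gcongr; exact Real.add_one_le_exp _
      _ = Real.exp (n * (m : ℝ)⁻¹) := (Real.exp_nat_mul _ _).symm
  rw [Real.exp_neg, ← div_eq_mul_inv, div_le_iff₀ (Real.exp_pos _), ← Real.exp_add] at hS
  refine hS.trans_eq ?_
  congr 1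
  field_simp

theorem mis_le_card_maximalIndepIn {V : Type*} [Fintype V] (G : SimpleGraph V) :
    mis G ≤ (maximalIndepIn G Finset.univ).card := by
  classical
  rw [mis, ← Set.ncard_coe_finset,
    ← Set.ncard_image_of_injective (maximalIndepIn G Finset.univ : Set (Finset V))
      (Finset.coe_injective (α := V))]
  refine Set.ncard_le_ncard (fun I hI => ?_) (Set.toFinite _)
  rw [Set.mem_ofPred_eq] at hI
  refine ⟨I.toFinset, ?_, by simp⟩
  rw [SetLike.mem_coe, mem_maximalIndepIn]
  have hind : ∀ a ∈ I, ∀ b ∈ I, ¬ G.Adj a b := fun a ha b hb hab =>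
    hI.prop ha hb hab.ne hab
  refine ⟨Finset.subset_univ _, by simpa using hind, fun v _ hv => ?_⟩
  by_contra! h
  simp only [Set.mem_toFinset] at h hv
  refine hv (hI.le_of_ge (y := insert v I) ?_ (Set.subset_insert v I) (Set.mem_insert v I))
  refine hI.prop.insert fun b hb _ => ⟨fun hvb => h b hb hvb.symm, h b hb⟩

theorem log_mis_le {V : Type*} [Fintype V] (G : SimpleGraph V) {d m : ℕ} (hm : 0 < m)
    (hmd : m < 2 * d) (hd : ∀ v, (G.neighborSet v).ncard = d) :
    Real.log (mis G) ≤ Fintype.card V * ((1 + Real.log m) / m) +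
      d * Fintype.card V / (2 * d - m) * (Real.log 3 / 3) := by
  classical
  set n := Fintype.card V
  have hmd' : (0 : ℝ) < 2 * d - m := by
    have : (m : ℝ) < 2 * d := by exact_mod_cast hmd
    linarith
  have hlog3 : 0 < Real.log 3 := Real.log_pos (by norm_num)
  have hm1 : 0 ≤ Real.log m := Real.log_natCast_nonneg m
  let S := (Finset.univ : Finset (Finset V)).filter fun T => m * T.card ≤ n
  have hcover : maximalIndepIn G Finset.univ ⊆
      S.biUnion fun T => maximalIndepIn G (container G m T) := fun I hI => by
    obtain ⟨T, hT, hIT⟩ := exists_fingerprint G hm hI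
    exact Finset.mem_biUnion.2 ⟨T, by simpa [S] using hT, hIT⟩
  have hterm : ∀ T ∈ S, ((maximalIndepIn G (container G m T)).card : ℝ) ≤
      Real.exp (d * n / (2 * d - m) * (Real.log 3 / 3)) := fun T _ => by
    refine (card_maximalIndepIn_le G (Real.exp_pos (Real.log 3 / 3)).le ?_ _).trans ?_
    · rw [← Real.exp_nat_mul, Nat.cast_ofNat, mul_div_cancel₀ _ three_ne_zero,
        Real.exp_log (by norm_num)]
    · rw [← Real.exp_nat_mul]
      gcongr
      rw [le_div_iff₀ hmd']
      have h : ((container G m T).card : ℝ) * (2 * d) ≤ d * n + (container G m T).card * m := by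
        exact_mod_cast card_container_mul_le G hd m T
      linarith
  have hbound : (mis G : ℝ) ≤ Real.exp (n * ((1 + Real.log m) / m) +
      d * n / (2 * d - m) * (Real.log 3 / 3)) := by
    calc (mis G : ℝ)
        ≤ ∑ T ∈ S, ((maximalIndepIn G (container G m T)).card : ℝ) := by
          exact_mod_cast (mis_le_card_maximalIndepIn G).trans
            ((Finset.card_le_card hcover).trans Finset.card_biUnion_le)
      _ ≤ S.card * Real.exp (d * n / (2 * d - m) * (Real.log 3 / 3)) := by
          simpa using Finset.sum_le_sum hterm
      _ ≤ _ := by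
          rw [Real.exp_add]
          gcongr
          exact card_small_sets_le hm
  rcases Nat.eq_zero_or_pos (mis G) with h0 | hpos
  · rw [h0, Nat.cast_zero, Real.log_zero]
    positivity
  · exact (Real.log_le_iff_le_exp (by exact_mod_cast hpos)).2 hbound

theorem tendsto_one_add_log_div_atTop :
    Filter.Tendsto (fun m : ℕ => (1 + Real.log m) / m) Filter.atTop (nhds 0) := by
  have h1 := tendsto_one_div_atTop_nhds_zero_nat (𝕜 := ℝ)
  have h2 := (Real.isLittleO_log_id_atTop.tendsto_div_nhds_zero).comp
    (tendsto_natCast_atTop_atTop (R := ℝ))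
  simpa [add_div, Function.comp_def] using h1.add h2

theorem log_mis_le_of_regular :
    ∀ ε : ℝ, 0 < ε → ∃ D : ℕ, ∀ d : ℕ, D ≤ d →
      ∀ (V : Type) [Fintype V] (G : SimpleGraph V),
        (∀ v : V, (G.neighborSet v).ncard = d) →
        Real.logb 2 (mis G) ≤ (1 + ε) * (Fintype.card V : ℝ) * Real.logb 2 3 / 6 := by
  intro ε hε
  have hlog3 : 0 < Real.log 3 := Real.log_pos (by norm_num)
  have hlog2 : 0 < Real.log 2 := Real.log_pos (by norm_num)
  obtain ⟨m, hm, hm0⟩ := ((tendsto_one_add_log_div_atTop.eventually_le_const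
    (show 0 < ε / 2 * (Real.log 3 / 6) by positivity)).and (Filter.eventually_gt_atTop 0)).exists
  obtain ⟨D, hD⟩ := exists_nat_ge ((1 + ε / 2) * m / ε)
  refine ⟨D, fun d hd V _ G hG => ?_⟩
  have hdε : (1 + ε / 2) * m ≤ ε * d := by
    have : (1 + ε / 2) * m / ε ≤ d := hD.trans (by exact_mod_cast hd)
    rw [div_le_iff₀ hε] at this
    linarith
  have hm0' : (0 : ℝ) < m := by exact_mod_cast hm0
  have hmd : (m : ℝ) < 2 * d := by
    by_contra! h
    nlinarith
  have hmain := log_mis_le G hm0 (by exact_mod_cast hmd) hG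
  have hfrac : d * (Fintype.card V : ℝ) / (2 * d - m) ≤ (1 + ε / 2) * Fintype.card V / 2 := by
    rw [div_le_div_iff₀ (by linarith) two_pos]
    have : (d : ℝ) * 2 ≤ (1 + ε / 2) * (2 * d - m) := by linarith
    nlinarith [mul_le_mul_of_nonneg_left this (Nat.cast_nonneg (α := ℝ) (Fintype.card V))]
  have hbound : Real.log (mis G) ≤ (1 + ε) * Fintype.card V * Real.log 3 / 6 := by
    have h1 := mul_le_mul_of_nonneg_left hm (Nat.cast_nonneg (α := ℝ) (Fintype.card V))
    have h2 := mul_le_mul_of_nonneg_right hfrac (show 0 ≤ Real.log 3 / 3 by positivity)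
    linarith
  rw [Real.logb, Real.logb, div_le_iff₀ hlog2]
  refine hbound.trans_eq ?_
  field_simp
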